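/- arXiv:2006.02048 — 2 statements merged into one kernel-verified Lean document; each statement's English description precedes it below -/
import Mathlib

section
/- Properties of the simulation: Fix senders i ≠ j and signals π_j of sender j and π_i of sender i such that for every a ∈ A, P(π_i = a) = P(π_j = a) and, whenever P(π_j = a) > 0, the posterior distribution of (ω_i, ω_R) given π_i = a equals the posterior distribution of (ω_i, ω_R) given π_j = a. Then: (1) if π_j is incentive compatible, so is π_i; (2) v_R(π_i) = v_R(π_j); and (3) v_i(π_i) = v_i(π_j). -/
open Finset

namespace Persuasion

variable {n : ℕ} {A ΩR : Type} {Ω : Fin n → Type}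
variable [Fintype A] [Fintype ΩR] [∀ k, Fintype (Ω k)]
variable [DecidableEq ΩR] [∀ k, DecidableEq (Ω k)]

/-- A signal for sender `k`: a map from `k`'s and the receiver's states to
distributions over messages/actions. -/
def IsSignal {k : Fin n} (π : Ω k × ΩR → A → ℝ) : Prop :=
  (∀ s a, 0 ≤ π s a) ∧ ∀ s, ∑ a, π s a = 1

/-- The joint distribution on `Ω × A` induced by the prior `μ0` and sender `k`'s signal `π`. -/
def jointP (μ0 : ((∀ k, Ω k) × ΩR) → ℝ) {k : Fin n}
    (π : Ω k × ΩR → A → ℝ) (ω : (∀ k, Ω k) × ΩR) (a : A) : ℝ :=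
  μ0 ω * π (ω.1 k, ω.2) a

/-- The probability that the signal `π` is realized as the message `a`. -/
def Pmsg (μ0 : ((∀ k, Ω k) × ΩR) → ℝ) {k : Fin n}
    (π : Ω k × ΩR → A → ℝ) (a : A) : ℝ :=
  ∑ ω, jointP μ0 π ω a

/-- The joint probability that `(ω_i, ω_R) = (ωi, ωR)` and the message is `a`. -/
def margIR (μ0 : ((∀ k, Ω k) × ΩR) → ℝ) {k : Fin n}
    (π : Ω k × ΩR → A → ℝ) (i : Fin n) (ωi : Ω i) (ωR : ΩR) (a : A) : ℝ :=
  ∑ ω ∈ univ.filter (fun ω : (∀ k, Ω k) × ΩR => ω.1 i = ωi ∧ ω.2 = ωR), jointP μ0 π ω a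

/-- The joint probability that `ω_i = ωi` and the message is `a`. -/
def margI (μ0 : ((∀ k, Ω k) × ΩR) → ℝ) {k : Fin n}
    (π : Ω k × ΩR → A → ℝ) (i : Fin n) (ωi : Ω i) (a : A) : ℝ :=
  ∑ ω ∈ univ.filter (fun ω : (∀ k, Ω k) × ΩR => ω.1 i = ωi), jointP μ0 π ω a

/-- The joint probability that `ω_R = ωR` and the message is `a`. -/
def margR (μ0 : ((∀ k, Ω k) × ΩR) → ℝ) {k : Fin n}
    (π : Ω k × ΩR → A → ℝ) (ωR : ΩR) (a : A) : ℝ :=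
  ∑ ω ∈ univ.filter (fun ω : (∀ k, Ω k) × ΩR => ω.2 = ωR), jointP μ0 π ω a

/-- The posterior probability of `(ω_i, ω_R) = (ωi, ωR)` given that the message is `a`. -/
noncomputable def posterior (μ0 : ((∀ k, Ω k) × ΩR) → ℝ) {k : Fin n}
    (π : Ω k × ΩR → A → ℝ) (i : Fin n) (ωi : Ω i) (ωR : ΩR) (a : A) : ℝ :=
  margIR μ0 π i ωi ωR a / Pmsg μ0 π a

/-- `E[u_R(b, ω_R) | π = a]`. -/
noncomputable def condExpR (μ0 : ((∀ k, Ω k) × ΩR) → ℝ) {k : Fin n}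
    (π : Ω k × ΩR → A → ℝ) (uR : A → ΩR → ℝ) (a b : A) : ℝ :=
  (∑ ω, jointP μ0 π ω a * uR b ω.2) / Pmsg μ0 π a

/-- Incentive compatibility: each realized message `a` is an optimal action for the
receiver given the posterior it induces. -/
def IC (μ0 : ((∀ k, Ω k) × ΩR) → ℝ) {k : Fin n}
    (π : Ω k × ΩR → A → ℝ) (uR : A → ΩR → ℝ) : Prop :=
  ∀ a, 0 < Pmsg μ0 π a → ∀ b, condExpR μ0 π uR a b ≤ condExpR μ0 π uR a a

/-- The receiver's expected utility `E[u_R(a, ω_R)]` from following the signal `π`. -/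
def vR (μ0 : ((∀ k, Ω k) × ΩR) → ℝ) {k : Fin n}
    (π : Ω k × ΩR → A → ℝ) (uR : A → ΩR → ℝ) : ℝ :=
  ∑ a, ∑ ω, jointP μ0 π ω a * uR a ω.2

/-- Sender `i`'s expected utility `E[u_i(a, ω_i)]` when the receiver follows signal `π`
(of sender `k`). -/
def vS (μ0 : ((∀ k, Ω k) × ΩR) → ℝ) {k : Fin n}
    (π : Ω k × ΩR → A → ℝ) (i : Fin n) (ui : A → Ω i → ℝ) : ℝ :=
  ∑ a, ∑ ω, jointP μ0 π ω a * ui a (ω.1 i)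

/-- The set of maximizers of `u` over `A`. -/
noncomputable def argmaxSet (u : A → ℝ) : Finset A :=
  univ.filter (fun a => ∀ b, u b ≤ u a)

/-- A signal is fully informative if any realized message `a`, in any receiver state `ωR`
that has positive probability jointly with `a`, is the receiver's unique optimal action. -/
noncomputable def FullyInformative (μ0 : ((∀ k, Ω k) × ΩR) → ℝ) {k : Fin n}
    (π : Ω k × ΩR → A → ℝ) (uR : A → ΩR → ℝ) : Prop :=
  ∀ a ωR, 0 < margR μ0 π ωR a → argmaxSet (fun b => uR b ωR) = {a}

/-- Assumption 1: every player has a unique optimal action in each of his states. -/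
noncomputable def Assumption1 (uR : A → ΩR → ℝ) (u : ∀ k : Fin n, A → Ω k → ℝ) : Prop :=
  (∀ ωR, (argmaxSet (fun a => uR a ωR)).card = 1) ∧
  ∀ (k : Fin n) (ωk : Ω k), (argmaxSet (fun a => u k a ωk)).card = 1

/-- Assumption 2: conditional on any positive-probability `(ω_j, ω_R)`, any other sender `i`
has, with positive probability, a state in which his preferences agree with the receiver's. -/
noncomputable def Assumption2 (μ0 : ((∀ k, Ω k) × ΩR) → ℝ) (uR : A → ΩR → ℝ)
    (u : ∀ k : Fin n, A → Ω k → ℝ) : Prop :=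
  ∀ i j : Fin n, i ≠ j → ∀ (ωj : Ω j) (ωR : ΩR),
    (0 < ∑ ω ∈ univ.filter (fun ω : (∀ k, Ω k) × ΩR => ω.1 j = ωj ∧ ω.2 = ωR), μ0 ω) →
    ∃ ωi : Ω i,
      (0 < ∑ ω ∈ univ.filter
        (fun ω : (∀ k, Ω k) × ΩR => ω.1 i = ωi ∧ ω.1 j = ωj ∧ ω.2 = ωR), μ0 ω) ∧
      argmaxSet (fun a => u i a ωi) = argmaxSet (fun a => uR a ωR)

/-- `E_{μ0}[max_{a ∈ A} u_R(a, ω_R)]`: the receiver's first-best expected utility. -/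
noncomputable def Emax [Nonempty A] (μ0 : ((∀ k, Ω k) × ΩR) → ℝ) (uR : A → ΩR → ℝ) : ℝ :=
  ∑ ω : (∀ k, Ω k) × ΩR, μ0 ω * univ.sup' univ_nonempty (fun a => uR a ω.2)

/-- The set of senders whose signals the receiver weakly prefers to all others. -/
noncomputable def BestSet (μ0 : ((∀ k, Ω k) × ΩR) → ℝ)
    (π : ∀ k : Fin n, Ω k × ΩR → A → ℝ) (uR : A → ΩR → ℝ) : Finset (Fin n) :=
  univ.filter (fun j => ∀ k, vR μ0 (π k) uR ≤ vR μ0 (π j) uR)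

/-- Sender `i`'s expected payoff under the uniform tie-breaking decision rule. -/
noncomputable def senderPayoff (μ0 : ((∀ k, Ω k) × ΩR) → ℝ)
    (π : ∀ k : Fin n, Ω k × ΩR → A → ℝ) (uR : A → ΩR → ℝ)
    (i : Fin n) (ui : A → Ω i → ℝ) : ℝ :=
  (∑ j ∈ BestSet μ0 π uR, vS μ0 (π j) i ui) / (BestSet μ0 π uR).card

/-- A pure Nash equilibrium of the persuasion game with the uniform tie-breaking rule. -/
noncomputable def PureNE (μ0 : ((∀ k, Ω k) × ΩR) → ℝ)
    (π : ∀ k : Fin n, Ω k × ΩR → A → ℝ) (uR : A → ΩR → ℝ)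
    (u : ∀ k : Fin n, A → Ω k → ℝ) : Prop :=
  (∀ k, IsSignal (π k) ∧ IC μ0 (π k) uR) ∧
  ∀ (i : Fin n) (π' : Ω i × ΩR → A → ℝ), IsSignal π' → IC μ0 π' uR →
    senderPayoff μ0 (Function.update π i π') uR i (u i) ≤ senderPayoff μ0 π uR i (u i)


/-- An optimal decision rule: for each profile of IC signals, a distribution over senders
supported on senders whose signals the receiver weakly prefers to all others. -/
def IsOptimalRule (μ0 : ((∀ k, Ω k) × ΩR) → ℝ) (uR : A → ΩR → ℝ)
    (D : (∀ k : Fin n, Ω k × ΩR → A → ℝ) → Fin n → ℝ) : Prop :=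
  ∀ π : ∀ k : Fin n, Ω k × ΩR → A → ℝ,
    (∀ k, IsSignal (π k) ∧ IC μ0 (π k) uR) →
    (∀ j, 0 ≤ D π j) ∧ (∑ j, D π j = 1) ∧
    ∀ i, 0 < D π i → ∀ j, vR μ0 (π j) uR ≤ vR μ0 (π i) uR

/-- Sender `i`'s expected payoff from profile `π` under decision rule `D`. -/
def payoffUnder (μ0 : ((∀ k, Ω k) × ΩR) → ℝ)
    (D : (∀ k : Fin n, Ω k × ΩR → A → ℝ) → Fin n → ℝ)
    (π : ∀ k : Fin n, Ω k × ΩR → A → ℝ) (i : Fin n) (ui : A → Ω i → ℝ) : ℝ :=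
  ∑ j, D π j * vS μ0 (π j) i ui

/-- A pure pessimistic Nash equilibrium: a profile of IC signals together with an optimal
decision rule `D` such that every unilateral IC deviation of a sender is unprofitable under
*some* optimal decision rule after the deviation. -/
def PessimisticNE (μ0 : ((∀ k, Ω k) × ΩR) → ℝ)
    (π : ∀ k : Fin n, Ω k × ΩR → A → ℝ) (uR : A → ΩR → ℝ)
    (u : ∀ k : Fin n, A → Ω k → ℝ)
    (D : (∀ k : Fin n, Ω k × ΩR → A → ℝ) → Fin n → ℝ) : Prop :=
  (∀ k, IsSignal (π k) ∧ IC μ0 (π k) uR) ∧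
  IsOptimalRule μ0 uR D ∧
  ∀ (i : Fin n) (π' : Ω i × ΩR → A → ℝ), IsSignal π' → IC μ0 π' uR →
    ∃ D', IsOptimalRule μ0 uR D' ∧
      payoffUnder μ0 D' (Function.update π i π') i (u i) ≤ payoffUnder μ0 D π i (u i)

theorem jointP_nonneg {μ0 : ((∀ k, Ω k) × ΩR) → ℝ} (hμ0 : ∀ ω, 0 ≤ μ0 ω) {k : Fin n}
    {π : Ω k × ΩR → A → ℝ} (hπ : IsSignal π) (ω : (∀ k, Ω k) × ΩR) (a : A) :
    0 ≤ jointP μ0 π ω a :=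
  mul_nonneg (hμ0 ω) (hπ.1 _ a)

theorem Pmsg_nonneg {μ0 : ((∀ k, Ω k) × ΩR) → ℝ} (hμ0 : ∀ ω, 0 ≤ μ0 ω) {k : Fin n}
    {π : Ω k × ΩR → A → ℝ} (hπ : IsSignal π) (a : A) : 0 ≤ Pmsg μ0 π a :=
  sum_nonneg fun ω _ => jointP_nonneg hμ0 hπ ω a

/-- Messages of probability zero have zero joint probability with every `(ω_i, ω_R)`. -/
theorem margIR_eq_zero {μ0 : ((∀ k, Ω k) × ΩR) → ℝ} (hμ0 : ∀ ω, 0 ≤ μ0 ω) {k : Fin n}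
    {π : Ω k × ΩR → A → ℝ} (hπ : IsSignal π) {a : A} (ha : Pmsg μ0 π a = 0)
    (i : Fin n) (ωi : Ω i) (ωR : ΩR) : margIR μ0 π i ωi ωR a = 0 :=
  sum_eq_zero fun ω _ =>
    (sum_eq_zero_iff_of_nonneg fun ω _ => jointP_nonneg hμ0 hπ ω a).1 ha ω (mem_univ ω)

/-- The expectation of a function of `(ω_i, ω_R)` on the event that the message is `a` only
depends on the marginal `margIR`. -/
theorem sum_jointP_mul (μ0 : ((∀ k, Ω k) × ΩR) → ℝ) {k : Fin n} (π : Ω k × ΩR → A → ℝ)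
    (i : Fin n) (f : Ω i → ΩR → ℝ) (a : A) :
    ∑ ω, jointP μ0 π ω a * f (ω.1 i) ω.2 =
      ∑ s : Ω i × ΩR, margIR μ0 π i s.1 s.2 a * f s.1 s.2 := by
  rw [← sum_fiberwise univ (fun ω : (∀ k, Ω k) × ΩR => (ω.1 i, ω.2))]
  refine sum_congr rfl fun s _ => ?_
  simp only [margIR, sum_mul, Prod.ext_iff]
  refine sum_congr rfl fun ω hω => ?_
  obtain ⟨h₁, h₂⟩ := (mem_filter.1 hω).2
  rw [h₁, h₂]

/-- Equal message probabilities and equal posteriors on messages of positive probability give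
equal joint distributions of `(ω_i, ω_R)` and the message. -/
theorem margIR_eq_of_posterior_eq {μ0 : ((∀ k, Ω k) × ΩR) → ℝ} (hμ0 : ∀ ω, 0 ≤ μ0 ω)
    {k l : Fin n} {π : Ω k × ΩR → A → ℝ} {ρ : Ω l × ΩR → A → ℝ}
    (hπ : IsSignal π) (hρ : IsSignal ρ) {a : A} (hmsg : Pmsg μ0 π a = Pmsg μ0 ρ a)
    {i : Fin n} {ωi : Ω i} {ωR : ΩR}
    (hpost : 0 < Pmsg μ0 ρ a → posterior μ0 π i ωi ωR a = posterior μ0 ρ i ωi ωR a) :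
    margIR μ0 π i ωi ωR a = margIR μ0 ρ i ωi ωR a := by
  rcases (Pmsg_nonneg hμ0 hρ a).eq_or_lt with h | h
  · rw [margIR_eq_zero hμ0 hρ h.symm, margIR_eq_zero hμ0 hπ (hmsg.trans h.symm)]
  · have hp := hpost h
    rwa [posterior, posterior, hmsg, div_left_inj' h.ne'] at hp

/-- properties of the simulation: if sender `i`'s signal `π_i` induces the
same message probabilities as sender `j`'s signal `π_j`, and the same posteriors over
`(ω_i, ω_R)` on positive-probability messages, then (1) `π_i` inherits incentive
compatibility from `π_j`, (2) `v_R(π_i) = v_R(π_j)`, and (3) `v_i(π_i) = v_i(π_j)`. -/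
theorem simulation_properties
    [Nonempty A] [Nonempty ΩR] [∀ k, Nonempty (Ω k)]
    (μ0 : ((∀ k, Ω k) × ΩR) → ℝ)
    (hμ0 : ∀ ω, 0 ≤ μ0 ω) (hμ1 : ∑ ω, μ0 ω = 1)
    (uR : A → ΩR → ℝ) (u : ∀ k : Fin n, A → Ω k → ℝ)
    (i j : Fin n) (hij : i ≠ j)
    (πj : Ω j × ΩR → A → ℝ) (πi : Ω i × ΩR → A → ℝ)
    (hπj : IsSignal πj) (hπi : IsSignal πi)
    (hmsg : ∀ a : A, Pmsg μ0 πi a = Pmsg μ0 πj a)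
    (hpost : ∀ a : A, 0 < Pmsg μ0 πj a → ∀ (ωi : Ω i) (ωR : ΩR),
      posterior μ0 πi i ωi ωR a = posterior μ0 πj i ωi ωR a) :
    (IC μ0 πj uR → IC μ0 πi uR) ∧
    vR μ0 πi uR = vR μ0 πj uR ∧
    vS μ0 πi i (u i) = vS μ0 πj i (u i) := by
  have hsum (f : Ω i → ΩR → ℝ) (a : A) :
      ∑ ω, jointP μ0 πi ω a * f (ω.1 i) ω.2 = ∑ ω, jointP μ0 πj ω a * f (ω.1 i) ω.2 := by
    rw [sum_jointP_mul, sum_jointP_mul]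
    refine sum_congr rfl fun s _ => ?_
    rw [margIR_eq_of_posterior_eq hμ0 hπi hπj (hmsg a) fun ha => hpost a ha s.1 s.2]
  refine ⟨fun hIC a ha b => ?_, sum_congr rfl fun a _ => hsum (fun _ ωR => uR a ωR) a,
    sum_congr rfl fun a _ => hsum (fun ωi _ => u i a ωi) a⟩
  have hcond (c : A) : condExpR μ0 πi uR a c = condExpR μ0 πj uR a c := by
    rw [condExpR, condExpR, hmsg a, hsum (fun _ ωR => uR c ωR) a]
  rw [hcond, hcond]
  exact hIC a (hmsg a ▸ ha) b

end Persuasion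
end

section
/- Mixing with full revelation strictly improves the receiver: Under Assumption 1, let π be an incentive-compatible signal of sender k that is not fully informative, and for ε ∈ (0,1] define the signal π^ε of sender k which, in each state (ω_k, ω_R), outputs argmax_{a∈A} u_R(a, ω_R) with probability ε and otherwise draws a message from π(ω_k, ω_R). Then π^ε is incentive compatible and v_R(π^ε) > v_R(π). -/
open Finset

namespace Persuasion

variable {n : ℕ} {A ΩR : Type} {Ω : Fin n → Type}
variable [Fintype A] [Fintype ΩR] [∀ k, Fintype (Ω k)]
variable [DecidableEq ΩR] [∀ k, DecidableEq (Ω k)]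

/-- Incentive compatibility without conditioning: the constraint for a message of probability
zero holds trivially. -/
theorem IC_iff_sum_le {μ0 : ((∀ k, Ω k) × ΩR) → ℝ} (hμ0 : ∀ ω, 0 ≤ μ0 ω) {k : Fin n}
    {π : Ω k × ΩR → A → ℝ} (hπ : IsSignal π) (uR : A → ΩR → ℝ) :
    IC μ0 π uR ↔ ∀ a b, ∑ ω, jointP μ0 π ω a * uR b ω.2 ≤ ∑ ω, jointP μ0 π ω a * uR a ω.2 := by
  have h0 := jointP_nonneg hμ0 hπ
  constructor
  · intro h a b
    rcases (sum_nonneg fun ω _ => h0 ω a : 0 ≤ Pmsg μ0 π a).lt_or_eq with hp | hp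
    · exact (div_le_div_iff_of_pos_right hp).1 (h a hp b)
    · have hz := (sum_eq_zero_iff_of_nonneg fun ω _ => h0 ω a).1 hp.symm
      exact (sum_congr rfl fun ω hω => by rw [hz ω hω, zero_mul, zero_mul]).le
  · intro h a hp b
    exact (div_le_div_iff_of_pos_right hp).2 (h a b)

theorem vR_eq_sum_states (μ0 : ((∀ k, Ω k) × ΩR) → ℝ) {k : Fin n}
    (π : Ω k × ΩR → A → ℝ) (uR : A → ΩR → ℝ) :
    vR μ0 π uR = ∑ ω, μ0 ω * ∑ a, π (ω.1 k, ω.2) a * uR a ω.2 := by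
  simp only [vR, jointP]
  rw [sum_comm]
  simp only [mul_sum, mul_assoc]

/-- under Assumption 1, mixing a non-fully-informative IC signal `π` with the
fully revealing signal (with any probability `ε ∈ (0,1]`) yields an incentive-compatible
signal that the receiver strictly prefers. -/
theorem mix_with_full_revelation
    [Nonempty A] [DecidableEq A] [Nonempty ΩR] [∀ k, Nonempty (Ω k)]
    (μ0 : ((∀ k, Ω k) × ΩR) → ℝ)
    (hμ0 : ∀ ω, 0 ≤ μ0 ω) (hμ1 : ∑ ω, μ0 ω = 1)
    (uR : A → ΩR → ℝ) (u : ∀ k : Fin n, A → Ω k → ℝ)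
    (hA1 : Assumption1 uR u)
    (k : Fin n) (π : Ω k × ΩR → A → ℝ) (hπ : IsSignal π) (hIC : IC μ0 π uR)
    (hnotFI : ¬ FullyInformative μ0 π uR)
    (ε : ℝ) (hε0 : 0 < ε) (hε1 : ε ≤ 1)
    (πε : Ω k × ΩR → A → ℝ)
    (hπε : ∀ s a, πε s a =
      ε * (if a ∈ argmaxSet (fun b => uR b s.2) then (1 : ℝ) else 0) + (1 - ε) * π s a) :
    IsSignal πε ∧ IC μ0 πε uR ∧ vR μ0 π uR < vR μ0 πε uR := by
  have hm : ∀ ωR, ∃ m, argmaxSet (fun b => uR b ωR) = {m} := fun ωR =>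
    card_eq_one.1 (hA1.1 ωR)
  choose m hm using hm
  have hmax : ∀ ωR b, uR b ωR ≤ uR (m ωR) ωR := fun ωR => by
    have h : m ωR ∈ argmaxSet (fun b => uR b ωR) := hm ωR ▸ mem_singleton_self _
    simpa [argmaxSet] using h
  have hlt : ∀ ωR b, b ≠ m ωR → uR b ωR < uR (m ωR) ωR := fun ωR b hb => by
    by_contra! h
    have hmem : b ∈ argmaxSet (fun b => uR b ωR) := by
      simpa [argmaxSet] using fun c => (hmax ωR c).trans h
    rw [hm] at hmem
    exact hb (mem_singleton.1 hmem)
  simp only [hm, mem_singleton] at hπε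
  have hsig : IsSignal πε := by
    refine ⟨fun s a => ?_, fun s => ?_⟩
    · rw [hπε]
      have := mul_nonneg (sub_nonneg.2 hε1) (hπ.1 s a)
      split_ifs <;> linarith
    · simp [hπε, sum_add_distrib, ← mul_sum, hπ.2]
  refine ⟨hsig, (IC_iff_sum_le hμ0 hsig uR).2 fun a b => ?_, ?_⟩
  · have hsplit : ∀ c, ∑ ω, jointP μ0 πε ω a * uR c ω.2 =
        ε * ∑ ω, μ0 ω * ((if a = m ω.2 then 1 else 0) * uR c ω.2) +
          (1 - ε) * ∑ ω, jointP μ0 π ω a * uR c ω.2 := fun c => by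
      rw [mul_sum, mul_sum, ← sum_add_distrib]
      refine sum_congr rfl fun ω _ => ?_
      rw [jointP, jointP, hπε]
      ring
    rw [hsplit, hsplit]
    have hrev : ∑ ω, μ0 ω * ((if a = m ω.2 then 1 else 0) * uR b ω.2) ≤
        ∑ ω, μ0 ω * ((if a = m ω.2 then 1 else 0) * uR a ω.2) := by
      refine sum_le_sum fun ω _ => mul_le_mul_of_nonneg_left ?_ (hμ0 ω)
      split_ifs with h
      · simpa [h] using hmax ω.2 b
      · simp
    exact add_le_add (mul_le_mul_of_nonneg_left hrev hε0.le)
      (mul_le_mul_of_nonneg_left ((IC_iff_sum_le hμ0 hπ uR).1 hIC a b) (sub_nonneg.2 hε1))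
  · have hgap : vR μ0 πε uR - vR μ0 π uR =
        ε * ∑ ω, ∑ a, jointP μ0 π ω a * (uR (m ω.2) ω.2 - uR a ω.2) := by
      rw [vR_eq_sum_states, vR_eq_sum_states, ← sum_sub_distrib, mul_sum]
      refine sum_congr rfl fun ω _ => ?_
      simp only [hπε, jointP, mul_sub, sum_sub_distrib, ← sum_mul, ← mul_sum, hπ.2, add_mul,
        sum_add_distrib, mul_assoc, ite_mul, one_mul, zero_mul, sum_ite_eq', mem_univ, if_true]
      ring
    have hterm : ∀ ω a, 0 ≤ jointP μ0 π ω a * (uR (m ω.2) ω.2 - uR a ω.2) := fun ω a =>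
      mul_nonneg (jointP_nonneg hμ0 hπ ω a) (sub_nonneg.2 (hmax ω.2 a))
    simp only [FullyInformative, not_forall] at hnotFI
    obtain ⟨a, ωR, hpos, hne⟩ := hnotFI
    obtain ⟨ω, hω, hωpos⟩ := (sum_pos_iff_of_nonneg fun ω _ => jointP_nonneg hμ0 hπ ω a).1 hpos
    obtain rfl : ω.2 = ωR := (mem_filter.1 hω).2
    have ha : a ≠ m ω.2 := fun h => hne (by rw [hm, h])
    have hsum : 0 < ∑ ω, ∑ a, jointP μ0 π ω a * (uR (m ω.2) ω.2 - uR a ω.2) :=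
      sum_pos' (fun ω _ => sum_nonneg fun a _ => hterm ω a) ⟨ω, mem_univ _,
        sum_pos' (fun a _ => hterm ω a)
          ⟨a, mem_univ _, mul_pos hωpos (sub_pos.2 (hlt ω.2 a ha))⟩⟩
    exact sub_pos.1 (hgap ▸ mul_pos hε0 hsum)

end Persuasion
end
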